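/- arXiv:quant-ph/0511029 — 2 statements merged into one kernel-verified Lean document; each statement's English description precedes it below -/
import Mathlib

section
/- Every symmetric state has large overlap with some product state: let k and d be positive integers and let ψ : (Fin k → Fin d) → ℂ satisfy ψ (x ∘ σ) = ψ x for every permutation σ of Fin k, together with ∑_x |ψ x|² = 1. Then there exists φ : Fin d → ℂ with ∑_i |φ i|² = 1 such that |∑_x conj (ψ x) * ∏_{j : Fin k} φ (x j)|² ≥ ((k + d - 1).choose (d - 1))⁻¹. -/
section

open MeasureTheory ComplexConjugate

/-- The density of the standard complex Gaussian measure on `ℂ`. -/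
noncomputable def complexGaussianDensity (z : ℂ) : ℝ := Real.exp (-‖z‖ ^ 2) / Real.pi

theorem integral_normSq_pow_mul_complexGaussianDensity (a : ℕ) :
    ∫ z : ℂ, ‖z‖ ^ (2 * a) * complexGaussianDensity z = a.factorial := by
  have h := Complex.integral_rpow_mul_exp_neg_rpow (p := 2) (q := (2 * a : ℕ)) (by norm_num)
    (by have : (0 : ℝ) ≤ (2 * a : ℕ) := Nat.cast_nonneg _
        linarith)
  have e : (((2 * a : ℕ) : ℝ) + 2) / 2 = a + 1 := by push_cast; ring
  simp only [Real.rpow_natCast, Real.rpow_two, e, Real.Gamma_nat_eq_factorial] at h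
  simp only [complexGaussianDensity, mul_div_assoc']
  rw [integral_div, h]
  field_simp

theorem integrable_normSq_pow_mul_complexGaussianDensity (a : ℕ) :
    Integrable fun z : ℂ => ‖z‖ ^ (2 * a) * complexGaussianDensity z := by
  by_contra h
  have := integral_undef h
  rw [integral_normSq_pow_mul_complexGaussianDensity] at this
  exact Nat.factorial_ne_zero a (by exact_mod_cast this)

theorem continuous_complexGaussianDensity : Continuous complexGaussianDensity := by
  unfold complexGaussianDensity
  fun_prop

theorem complexGaussianDensity_nonneg (z : ℂ) : 0 ≤ complexGaussianDensity z := by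
  unfold complexGaussianDensity
  positivity

theorem integrable_pow_mul_conj_pow_mul_complexGaussianDensity (a b : ℕ) :
    Integrable fun z : ℂ => z ^ a * conj z ^ b * complexGaussianDensity z := by
  refine ((integrable_normSq_pow_mul_complexGaussianDensity a).add
    (integrable_normSq_pow_mul_complexGaussianDensity b)).mono' ?_ (ae_of_all _ fun z => ?_)
  · have := continuous_complexGaussianDensity
    exact Continuous.aestronglyMeasurable (by fun_prop)
  · have h := complexGaussianDensity_nonneg z
    simp only [norm_mul, norm_pow, RCLike.norm_conj, Complex.norm_real, Real.norm_of_nonneg h,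
      Pi.add_apply, ← add_mul]
    gcongr
    rw [mul_comm 2 a, mul_comm 2 b, pow_mul, pow_mul]
    nlinarith [sq_nonneg (‖z‖ ^ a - ‖z‖ ^ b), sq_nonneg (‖z‖ ^ a), sq_nonneg (‖z‖ ^ b)]

theorem integral_pow_mul_conj_pow_mul_complexGaussianDensity (a b : ℕ) :
    ∫ z : ℂ, z ^ a * conj z ^ b * complexGaussianDensity z =
      if a = b then (a.factorial : ℂ) else 0 := by
  split_ifs with hab
  · subst hab
    have h := congrArg ((↑) : ℝ → ℂ) (integral_normSq_pow_mul_complexGaussianDensity a)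
    rw [← integral_complex_ofReal] at h
    push_cast at h
    rw [← h]
    congr 1 with z
    rw [← mul_pow, Complex.mul_conj', pow_mul]
  · have hab' : (a : ℝ) - b ≠ 0 := sub_ne_zero.2 (by exact_mod_cast hab)
    set c : Circle := Circle.exp (Real.pi / (a - b))
    have hc : (c : ℂ) ^ a * conj (c : ℂ) ^ b = -1 := by
      rw [← Circle.coe_inv_eq_conj, ← Circle.coe_pow, ← Circle.coe_pow, ← Circle.coe_mul,
        ← Circle.exp_neg, ← Circle.exp_nsmul, ← Circle.exp_nsmul, ← Circle.exp_add]
      have : a • (Real.pi / (a - b)) + b • -(Real.pi / ((a : ℝ) - b)) = Real.pi := by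
        simp only [nsmul_eq_mul]
        field_simp
        ring
      rw [this]
      simp [Circle.coe_exp]
    have h := (rotation c).measurePreserving.integral_comp
      (rotation c).toHomeomorph.measurableEmbedding
      (fun z : ℂ => z ^ a * conj z ^ b * (complexGaussianDensity z : ℂ))
    have e (z : ℂ) : (rotation c z) ^ a * conj (rotation c z) ^ b *
        (complexGaussianDensity (rotation c z) : ℂ) =
        -(z ^ a * conj z ^ b * complexGaussianDensity z) := by
      have hd : complexGaussianDensity (rotation c z) = complexGaussianDensity z := by
        simp only [complexGaussianDensity, LinearIsometryEquiv.norm_map]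
      rw [hd, rotation_apply, map_mul, mul_pow, mul_pow]
      linear_combination (z ^ a * conj z ^ b * complexGaussianDensity z) * hc
    simp only [e, integral_neg] at h
    exact self_eq_neg.1 h.symm

theorem exists_perm_comp_eq_of_card_fiber_eq {ι κ : Type*} [Fintype κ] [DecidableEq ι]
    {x y : κ → ι}
    (h : ∀ i, Fintype.card {j // x j = i} = Fintype.card {j // y j = i}) :
    ∃ σ : Equiv.Perm κ, y ∘ σ = x :=
  ⟨Equiv.ofFiberEquiv fun i => Fintype.equivOfCardEq (h i),
    funext fun j => Equiv.ofFiberEquiv_map _ j⟩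

theorem card_fiber_comp_perm {ι κ : Type*} [Fintype κ] [DecidableEq ι]
    (x : κ → ι) (σ : Equiv.Perm κ) (i : ι) :
    Fintype.card {j // (x ∘ σ) j = i} = Fintype.card {j // x j = i} :=
  Fintype.card_congr (σ.subtypeEquiv fun _ => Iff.rfl)

section Wick

variable {ι κ : Type*} [Fintype ι] [Fintype κ]

/-- The density of the standard complex Gaussian measure on `ι → ℂ`. -/
noncomputable def piGaussianDensity (φ : ι → ℂ) : ℝ := ∏ i, complexGaussianDensity (φ i)

theorem piGaussianDensity_nonneg (φ : ι → ℂ) : 0 ≤ piGaussianDensity φ :=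
  Finset.prod_nonneg fun i _ => complexGaussianDensity_nonneg (φ i)

theorem integrable_monomial_mul_piGaussianDensity (a b : ι → ℕ) :
    Integrable fun φ : ι → ℂ =>
      (∏ i, φ i ^ a i) * (∏ i, conj (φ i) ^ b i) * piGaussianDensity φ := by
  simp only [piGaussianDensity, Complex.ofReal_prod, ← Finset.prod_mul_distrib]
  exact Integrable.fintype_prod fun i =>
    integrable_pow_mul_conj_pow_mul_complexGaussianDensity (a i) (b i)

theorem integral_monomial_mul_piGaussianDensity [DecidableEq ι] (a b : ι → ℕ) :
    ∫ φ : ι → ℂ, (∏ i, φ i ^ a i) * (∏ i, conj (φ i) ^ b i) * piGaussianDensity φ =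
      if a = b then ∏ i, ((a i).factorial : ℂ) else 0 := by
  simp only [piGaussianDensity, Complex.ofReal_prod, ← Finset.prod_mul_distrib]
  rw [integral_fintype_prod_volume_eq_prod
    (fun i z => z ^ a i * conj z ^ b i * (complexGaussianDensity z : ℂ))]
  simp only [integral_pow_mul_conj_pow_mul_complexGaussianDensity]
  split_ifs with h
  · simp [h]
  · obtain ⟨i, hi⟩ := Function.ne_iff.1 h
    exact Finset.prod_eq_zero (Finset.mem_univ i) (if_neg hi)

theorem prod_comp_eq_prod_pow_card_fiber [DecidableEq ι] {M : Type*} [CommMonoid M]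
    (f : ι → M) (x : κ → ι) :
    ∏ j, f (x j) = ∏ i, f i ^ Fintype.card {j // x j = i} := by
  rw [← Finset.prod_fiberwise' Finset.univ x f]
  simp [Fintype.card_subtype]

theorem card_perm_comp_eq [DecidableEq ι] [DecidableEq κ] (x y : κ → ι) :
    Fintype.card {σ : Equiv.Perm κ // y ∘ σ = x} =
      if (fun i => Fintype.card {j // x j = i}) = (fun i => Fintype.card {j // y j = i})
      then ∏ i, (Fintype.card {j // x j = i}).factorial else 0 := by
  split_ifs with h
  · obtain ⟨τ, rfl⟩ := exists_perm_comp_eq_of_card_fiber_eq (congrFun h)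
    simp only [card_fiber_comp_perm]
    rw [← DomMulAct.stabilizer_card]
    refine Fintype.card_congr ((Equiv.mulRight τ⁻¹).subtypeEquiv fun σ => ?_)
    rw [Equiv.coe_mulRight, Equiv.Perm.coe_mul, ← Function.comp_assoc]
    exact (Equiv.comp_symm_eq τ _ _).symm
  · refine Fintype.card_eq_zero_iff.2 ⟨fun σ => h ?_⟩
    obtain ⟨σ, rfl⟩ := σ
    exact funext (card_fiber_comp_perm y σ)

theorem integrable_prod_mul_conj_prod_mul_piGaussianDensity (x y : κ → ι) :
    Integrable fun φ : ι → ℂ =>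
      (∏ j, φ (x j)) * (∏ j, conj (φ (y j))) * piGaussianDensity φ := by
  classical
  simp only [fun φ : ι → ℂ => prod_comp_eq_prod_pow_card_fiber φ x,
    fun φ : ι → ℂ => prod_comp_eq_prod_pow_card_fiber (fun i => conj (φ i)) y]
  exact integrable_monomial_mul_piGaussianDensity _ _

/-- Wick's formula for the standard complex Gaussian measure. -/
theorem integral_prod_mul_conj_prod_mul_piGaussianDensity [DecidableEq ι] [DecidableEq κ]
    (x y : κ → ι) :
    ∫ φ : ι → ℂ, (∏ j, φ (x j)) * (∏ j, conj (φ (y j))) * piGaussianDensity φ =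
      Fintype.card {σ : Equiv.Perm κ // y ∘ σ = x} := by
  simp only [fun φ : ι → ℂ => prod_comp_eq_prod_pow_card_fiber φ x,
    fun φ : ι → ℂ => prod_comp_eq_prod_pow_card_fiber (fun i => conj (φ i)) y]
  rw [integral_monomial_mul_piGaussianDensity, card_perm_comp_eq]
  push_cast
  rfl

/-- The overlap of `ψ` with the product state `φ^{⊗κ}`. -/
noncomputable def productOverlap [DecidableEq κ] (ψ : (κ → ι) → ℂ) (φ : ι → ℂ) : ℂ :=
  ∑ x, conj (ψ x) * ∏ j, φ (x j)

theorem normSq_productOverlap_mul_piGaussianDensity [DecidableEq κ]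
    (ψ : (κ → ι) → ℂ) (φ : ι → ℂ) :
    ((‖productOverlap ψ φ‖ ^ 2 * piGaussianDensity φ : ℝ) : ℂ) =
      ∑ y, ∑ x, ψ y * conj (ψ x) *
        ((∏ j, φ (x j)) * (∏ j, conj (φ (y j))) * piGaussianDensity φ) := by
  push_cast
  rw [← Complex.conj_mul', productOverlap]
  simp only [map_sum, map_mul, map_prod, Complex.conj_conj]
  rw [Finset.sum_mul_sum, Finset.sum_mul]
  simp only [Finset.sum_mul]
  refine Finset.sum_congr rfl fun y _ => Finset.sum_congr rfl fun x _ => ?_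
  ring

theorem integrable_normSq_productOverlap_mul_piGaussianDensity [DecidableEq κ]
    (ψ : (κ → ι) → ℂ) :
    Integrable fun φ : ι → ℂ => ‖productOverlap ψ φ‖ ^ 2 * piGaussianDensity φ := by
  refine Integrable.re (𝕜 := ℂ)
    (f := fun φ => ((‖productOverlap ψ φ‖ ^ 2 * piGaussianDensity φ : ℝ) : ℂ)) ?_
  simp only [normSq_productOverlap_mul_piGaussianDensity]
  exact integrable_finsetSum _ fun y _ => integrable_finsetSum _ fun x _ =>
    (integrable_prod_mul_conj_prod_mul_piGaussianDensity x y).const_mul _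

theorem integral_normSq_productOverlap_mul_piGaussianDensity [DecidableEq κ]
    {ψ : (κ → ι) → ℂ}
    (hsym : ∀ σ : Equiv.Perm κ, ∀ x : κ → ι, ψ (x ∘ σ) = ψ x) :
    ∫ φ : ι → ℂ, ‖productOverlap ψ φ‖ ^ 2 * piGaussianDensity φ =
      (Fintype.card κ).factorial * ∑ x, ‖ψ x‖ ^ 2 := by
  classical
  apply Complex.ofReal_injective
  rw [← integral_complex_ofReal]
  simp only [normSq_productOverlap_mul_piGaussianDensity]
  have hint (x y : κ → ι) := (integrable_prod_mul_conj_prod_mul_piGaussianDensity x y).const_mul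
    (ψ y * conj (ψ x))
  rw [integral_finsetSum _ fun y _ => integrable_finsetSum _ fun x _ => hint x y]
  push_cast
  rw [Finset.mul_sum]
  refine Finset.sum_congr rfl fun y _ => ?_
  rw [integral_finsetSum _ fun x _ => hint x y]
  simp only [integral_const_mul, integral_prod_mul_conj_prod_mul_piGaussianDensity,
    Fintype.card_subtype, Finset.card_filter, Nat.cast_sum, Finset.mul_sum]
  rw [Finset.sum_comm]
  simp [hsym, Complex.mul_conj', Fintype.card_perm]

theorem card_piAntidiag_univ {ι : Type*} [Fintype ι] [DecidableEq ι] (n : ℕ) :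
    (Finset.piAntidiag (Finset.univ : Finset ι) n).card = (Fintype.card ι + n - 1).choose n := by
  rw [← Finset.map_sym_eq_piAntidiag, Finset.card_map, Finset.sym_univ, Finset.card_univ,
    Sym.card_sym_eq_choose]

theorem sum_normSq_pow_mul_piGaussianDensity [DecidableEq ι] (n : ℕ) (φ : ι → ℂ) :
    (((∑ i, ‖φ i‖ ^ 2) ^ n * piGaussianDensity φ : ℝ) : ℂ) =
      ∑ a ∈ Finset.piAntidiag Finset.univ n, (Nat.multinomial Finset.univ a : ℂ) *
        ((∏ i, φ i ^ a i) * (∏ i, conj (φ i) ^ a i) * piGaussianDensity φ) := by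
  push_cast
  rw [Finset.sum_pow_eq_sum_piAntidiag, Finset.sum_mul]
  simp only [← Finset.prod_mul_distrib, ← mul_pow, Complex.mul_conj', mul_assoc]

theorem integrable_sum_normSq_pow_mul_piGaussianDensity (n : ℕ) :
    Integrable fun φ : ι → ℂ => (∑ i, ‖φ i‖ ^ 2) ^ n * piGaussianDensity φ := by
  classical
  refine Integrable.re (𝕜 := ℂ)
    (f := fun φ => (((∑ i, ‖φ i‖ ^ 2) ^ n * piGaussianDensity φ : ℝ) : ℂ)) ?_
  simp only [sum_normSq_pow_mul_piGaussianDensity]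
  exact integrable_finsetSum _ fun a _ =>
    (integrable_monomial_mul_piGaussianDensity a a).const_mul _

theorem integral_sum_normSq_pow_mul_piGaussianDensity (n : ℕ) :
    ∫ φ : ι → ℂ, (∑ i, ‖φ i‖ ^ 2) ^ n * piGaussianDensity φ =
      n.factorial * (Fintype.card ι + n - 1).choose n := by
  classical
  apply Complex.ofReal_injective
  rw [← integral_complex_ofReal]
  simp only [sum_normSq_pow_mul_piGaussianDensity]
  rw [integral_finsetSum _ fun a _ =>
    (integrable_monomial_mul_piGaussianDensity a a).const_mul _]
  simp only [integral_const_mul, integral_monomial_mul_piGaussianDensity, if_true]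
  have h : ∀ a ∈ Finset.piAntidiag (Finset.univ : Finset ι) n,
      (Nat.multinomial Finset.univ a : ℂ) * ∏ i, ((a i).factorial : ℂ) = n.factorial := by
    intro a ha
    rw [← (Finset.mem_piAntidiag.1 ha).1, ← Nat.multinomial_spec]
    push_cast
    ring
  rw [Finset.sum_congr rfl h, Finset.sum_const, card_piAntidiag_univ]
  simp [mul_comm]

theorem isCompact_sum_normSq_eq_one : IsCompact {φ : ι → ℂ | ∑ i, ‖φ i‖ ^ 2 = 1} := by
  refine (isCompact_closedBall (0 : ι → ℂ) 1).of_isClosed_subset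
    (isClosed_eq (by fun_prop) continuous_const) fun φ hφ => ?_
  rw [mem_closedBall_zero_iff, pi_norm_le_iff_of_nonneg zero_le_one]
  intro i
  rw [← sq_le_one_iff₀ (norm_nonneg _), ← show ∑ i, ‖φ i‖ ^ 2 = 1 from hφ]
  exact Finset.single_le_sum (f := fun i => ‖φ i‖ ^ 2) (fun i _ => sq_nonneg _)
    (Finset.mem_univ i)

theorem productOverlap_smul [DecidableEq κ] (ψ : (κ → ι) → ℂ) (c : ℂ) (φ : ι → ℂ) :
    productOverlap ψ (c • φ) = c ^ Fintype.card κ * productOverlap ψ φ := by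
  simp only [productOverlap, Pi.smul_apply, smul_eq_mul, Finset.prod_mul_distrib,
    Finset.prod_const, Finset.card_univ, Finset.mul_sum]
  exact Finset.sum_congr rfl fun x _ => by ring

theorem normSq_productOverlap_le [DecidableEq κ] [Nonempty κ]
    {ψ : (κ → ι) → ℂ} {M : ℝ}
    (hM : ∀ φ : ι → ℂ, ∑ i, ‖φ i‖ ^ 2 = 1 → ‖productOverlap ψ φ‖ ^ 2 ≤ M) (φ : ι → ℂ) :
    ‖productOverlap ψ φ‖ ^ 2 ≤ M * (∑ i, ‖φ i‖ ^ 2) ^ Fintype.card κ := by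
  have hN : 0 ≤ ∑ i, ‖φ i‖ ^ 2 := Finset.sum_nonneg fun i _ => sq_nonneg _
  set N := ∑ i, ‖φ i‖ ^ 2 with hNdef
  rcases hN.eq_or_lt with h0 | hpos
  · have hφ : φ = (0 : ℂ) • φ := by
      have := (Finset.sum_eq_zero_iff_of_nonneg fun i _ => sq_nonneg ‖φ i‖).1 (hNdef ▸ h0.symm)
      ext i
      simpa using this i
    rw [hφ, productOverlap_smul, ← h0]
    simp
  · have hs : ((√N : ℝ) : ℂ) ≠ 0 := by
      exact_mod_cast (Real.sqrt_pos.2 hpos).ne'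
    have hunit : ∑ i, ‖(((√N : ℝ) : ℂ)⁻¹ • φ) i‖ ^ 2 = 1 := by
      simp only [Pi.smul_apply, smul_eq_mul, norm_mul, norm_inv, Complex.norm_real,
        Real.norm_of_nonneg (Real.sqrt_nonneg N), mul_pow, inv_pow, Real.sq_sqrt hN]
      rw [← Finset.mul_sum, ← hNdef, inv_mul_cancel₀ hpos.ne']
    have h := hM _ hunit
    rw [← smul_inv_smul₀ hs φ, productOverlap_smul, norm_mul, norm_pow, Complex.norm_real,
      Real.norm_of_nonneg (Real.sqrt_nonneg N), mul_pow, ← pow_mul, mul_comm (Fintype.card κ) 2,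
      pow_mul, Real.sq_sqrt hN, mul_comm]
    gcongr

theorem one_le_mul_choose_of_normSq_productOverlap_le [DecidableEq κ] [Nonempty κ]
    {ψ : (κ → ι) → ℂ}
    (hsym : ∀ σ : Equiv.Perm κ, ∀ x : κ → ι, ψ (x ∘ σ) = ψ x) (hnorm : ∑ x, ‖ψ x‖ ^ 2 = 1)
    {M : ℝ} (hM : ∀ φ : ι → ℂ, ∑ i, ‖φ i‖ ^ 2 = 1 → ‖productOverlap ψ φ‖ ^ 2 ≤ M) :
    1 ≤ M * (Fintype.card ι + Fintype.card κ - 1).choose (Fintype.card κ) := by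
  have h := integral_mono (integrable_normSq_productOverlap_mul_piGaussianDensity ψ)
    ((integrable_sum_normSq_pow_mul_piGaussianDensity (ι := ι) (Fintype.card κ)).const_mul M)
    fun φ => by
      simp only [← mul_assoc]
      exact mul_le_mul_of_nonneg_right (normSq_productOverlap_le hM φ)
        (piGaussianDensity_nonneg φ)
  rw [integral_normSq_productOverlap_mul_piGaussianDensity hsym, hnorm, integral_const_mul,
    integral_sum_normSq_pow_mul_piGaussianDensity, mul_left_comm] at h
  exact le_of_mul_le_mul_left h (by positivity)

end Wick

end

/-- Every symmetric state has overlap at least `1 / dim (symmetric subspace)` with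
some product state. -/
theorem symmetric_state_overlap_with_product_state (k d : ℕ) (hk : 0 < k) (hd : 0 < d)
    (ψ : (Fin k → Fin d) → ℂ)
    (hsym : ∀ σ : Equiv.Perm (Fin k), ∀ x : Fin k → Fin d, ψ (x ∘ σ) = ψ x)
    (hnorm : ∑ x, ‖ψ x‖ ^ 2 = 1) :
    ∃ φ : Fin d → ℂ, (∑ i, ‖φ i‖ ^ 2 = 1) ∧
      (((k + d - 1).choose (d - 1) : ℝ))⁻¹ ≤
        ‖∑ x, (starRingEnd ℂ) (ψ x) * ∏ j, φ (x j)‖ ^ 2 := by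
  have : Nonempty (Fin k) := ⟨⟨0, hk⟩⟩
  obtain ⟨φ, hφ, hmax⟩ := (isCompact_sum_normSq_eq_one (ι := Fin d)).exists_isMaxOn
    ⟨Pi.single ⟨0, hd⟩ 1, by simp [Pi.single_apply, apply_ite]⟩
    (f := fun φ => ‖productOverlap ψ φ‖ ^ 2)
    (by unfold productOverlap; fun_prop)
  have h := one_le_mul_choose_of_normSq_productOverlap_le hsym hnorm fun φ' hφ' => hmax hφ'
  refine ⟨φ, hφ, ?_⟩
  have hpos : 0 < (k + d - 1).choose (d - 1) := Nat.choose_pos (by omega)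
  rw [Fintype.card_fin, Fintype.card_fin, add_comm d k,
    ← Nat.choose_symm_of_eq_add (show k + d - 1 = d - 1 + k by omega)] at h
  rw [inv_le_iff_one_le_mul₀ (by exact_mod_cast hpos)]
  exact h
end

section
/- Schur's lemma averaging formula for the symmetric subspace: let k and d be positive integers, let μ be the Haar probability measure on the unitary group U(d) (Matrix.unitaryGroup (Fin d) ℂ), and let φ₀ : Fin d → ℂ be a unit vector (∑_i |φ₀ i|² = 1). Then for all x, y : Fin k → Fin d, ∫ U, (∏_{j : Fin k} (U.mulVec φ₀) (x j) * conj ((U.mulVec φ₀) (y j))) dμ(U) = (((k + d - 1).choose (d - 1) : ℂ))⁻¹ * ((k.factorial : ℂ))⁻¹ * ∑_{σ : Equiv.Perm (Fin k)} ∏_{j : Fin k} (if x j = y (σ j) then (1:ℂ) else 0). -/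
open MeasureTheory

section Combinatorics

open Finset

theorem card_piAntidiag_univ_s11 (d k : ℕ) (hd : 0 < d) :
    #(piAntidiag (univ : Finset (Fin d)) k) = (k + d - 1).choose (d - 1) := by
  rw [← map_sym_eq_piAntidiag, card_map, sym_univ, card_univ, Sym.card_sym_eq_choose,
    Fintype.card_fin, show d + k - 1 = (d - 1) + k by omega, show k + d - 1 = (d - 1) + k by omega,
    Nat.choose_symm_add]

variable {κ ι : Type*} [Fintype κ] [DecidableEq ι]

theorem exists_perm_eq_comp_of_card_fiber_eq {x y : κ → ι}
    (h : ∀ i, #{j | x j = i} = #{j | y j = i}) : ∃ τ : Equiv.Perm κ, x = y ∘ τ := by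
  have e (i : ι) : {j // x j = i} ≃ {j // y j = i} :=
    Fintype.equivOfCardEq (by simpa [Fintype.card_subtype] using h i)
  refine ⟨Equiv.ofFiberEquiv e, ?_⟩
  funext j
  exact (Equiv.ofFiberEquiv_map e j).symm

variable [DecidableEq κ] [Fintype ι]

theorem card_perm_eq_comp {x y : κ → ι} (h : ∀ i, #{j | x j = i} = #{j | y j = i}) :
    #{σ : Equiv.Perm κ | x = y ∘ σ} = ∏ i, (#{j | x j = i}).factorial := by
  obtain ⟨τ, rfl⟩ := exists_perm_eq_comp_of_card_fiber_eq h
  simp_rw [h]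
  have := DomMulAct.stabilizer_card y
  simp only [Fintype.card_subtype] at this
  rw [← this]
  refine card_bij' (fun σ _ => σ * τ⁻¹) (fun σ _ => σ * τ) ?_ ?_ ?_ ?_
  · intro σ hσ
    simp only [mem_filter, mem_univ, true_and] at hσ ⊢
    funext j
    simpa using (congrFun hσ (τ⁻¹ j)).symm
  · intro σ hσ
    simp only [mem_filter, mem_univ, true_and] at hσ ⊢
    funext j
    simpa using (congrFun hσ (τ j)).symm
  · simp
  · simp

theorem sum_perm_prod_ite (R : Type*) [CommSemiring R] (x y : κ → ι) :
    ∑ σ : Equiv.Perm κ, ∏ j, (if x j = y (σ j) then (1 : R) else 0) =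
      if (fun i => #{j | x j = i}) = (fun i => #{j | y j = i}) then
        ((∏ i, (#{j | x j = i}).factorial : ℕ) : R) else 0 := by
  have h1 (σ : Equiv.Perm κ) : ∏ j, (if x j = y (σ j) then (1 : R) else 0) =
      if x = y ∘ σ then 1 else 0 := by
    rw [prod_ite_zero]
    simp [funext_iff]
  simp_rw [h1]
  rw [sum_boole]
  split_ifs with h
  · rw [card_perm_eq_comp (congrFun h)]
  · rw [filter_false_of_mem, card_empty, Nat.cast_zero]
    rintro σ - rfl
    refine h (funext fun i => ?_)
    refine card_bij (fun j _ => σ j) (by simp) (by simp) fun j hj => ⟨σ⁻¹ j, ?_, by simp⟩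
    simpa using hj

theorem coeff_eq_of_forall_sum_eq (k : ℕ) (a b : (ι → ℕ) → ℂ)
    (h : ∀ t : ι → ℝ, (∀ i, 0 ≤ t i) →
      ∑ α ∈ piAntidiag univ k, a α * ∏ i, (t i : ℂ) ^ α i =
        ∑ α ∈ piAntidiag univ k, b α * ∏ i, (t i : ℂ) ^ α i) :
    ∀ α ∈ piAntidiag univ k, a α = b α := by
  let P (a : (ι → ℕ) → ℂ) : MvPolynomial ι ℂ :=
    ∑ α ∈ piAntidiag univ k, MvPolynomial.monomial (Finsupp.equivFunOnFinite.symm α) (a α)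
  have heval (a : (ι → ℕ) → ℂ) (x : ι → ℂ) : MvPolynomial.eval x (P a) =
      ∑ α ∈ piAntidiag univ k, a α * ∏ i, x i ^ α i := by
    simp only [P, map_sum, MvPolynomial.eval_monomial]
    refine sum_congr rfl fun α _ => ?_
    rw [Finsupp.prod_fintype _ _ (by simp)]
    simp
  have hcoeff (a : (ι → ℕ) → ℂ) (α) (hα : α ∈ piAntidiag univ k) :
      (P a).coeff (Finsupp.equivFunOnFinite.symm α) = a α := by
    simp only [P, MvPolynomial.coeff_sum, MvPolynomial.coeff_monomial,
      EmbeddingLike.apply_eq_iff_eq]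
    simp [hα]
  have hP : P a = P b := by
    refine MvPolynomial.funext_set (fun _ => (fun r : ℝ => (r : ℂ)) '' Set.Ici 0)
      (fun _ => (Set.Ici_infinite 0).image Complex.ofReal_injective.injOn) fun x hx => ?_
    choose t ht hxt using fun i => hx i (Set.mem_univ i)
    obtain rfl : (fun i => (t i : ℂ)) = x := funext hxt
    rw [heval, heval, h t ht]
  intro α hα
  rw [← hcoeff a α hα, ← hcoeff b α hα, hP]

end Combinatorics

section Unitary

open Matrix

variable {ι : Type*} [Fintype ι] [DecidableEq ι]

theorem sum_norm_sq_unitary_mulVec (U : unitaryGroup ι ℂ) (φ : ι → ℂ) :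
    ∑ i, ‖((U : Matrix ι ι ℂ) *ᵥ φ) i‖ ^ 2 = ∑ i, ‖φ i‖ ^ 2 := by
  have key (ψ : ι → ℂ) : ((∑ i, ‖ψ i‖ ^ 2 : ℝ) : ℂ) = star ψ ⬝ᵥ ψ := by
    simp [dotProduct, Complex.conj_mul']
  apply Complex.ofReal_injective
  rw [key, key, star_mulVec, dotProduct_mulVec, vecMul_vecMul, ← star_eq_conjTranspose,
    UnitaryGroup.star_mul_self, vecMul_one]

theorem exists_unitary_row_eq (i₀ : ι) (u : ι → ℝ) (hu : ∑ i, u i ^ 2 = 1) :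
    ∃ W : unitaryGroup ι ℂ, ∀ i, (W : Matrix ι ι ℂ) i₀ i = u i := by
  let v : EuclideanSpace ℂ ι := WithLp.toLp 2 fun i => (u i : ℂ)
  have hv : ‖v‖ = 1 := by
    rw [EuclideanSpace.norm_eq]
    simp [v, hu]
  obtain ⟨b, hb⟩ := Orthonormal.exists_orthonormalBasis_extension_of_card_eq (𝕜 := ℂ)
    (E := EuclideanSpace ℂ ι) (ι := ι) (by simp) (v := fun _ => v) (s := {i₀})
    ⟨fun _ => hv, fun i j hij => (hij (Subsingleton.elim i j)).elim⟩
  refine ⟨⟨b.toBasis.toMatrix (EuclideanSpace.basisFun ι ℂ),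
    b.toMatrix_orthonormalBasis_mem_unitary _⟩, fun i => ?_⟩
  simp [Module.Basis.toMatrix_apply, b.repr_apply_apply, hb i₀ rfl, v,
    EuclideanSpace.inner_single_right]

theorem mem_unitaryGroup_diagonal {z : ι → ℂ} (hz : ∀ i, ‖z i‖ = 1) :
    diagonal z ∈ unitaryGroup ι ℂ := by
  rw [mem_unitaryGroup_iff, star_eq_conjTranspose, diagonal_conjTranspose, diagonal_mul_diagonal,
    ← diagonal_one]
  congr 1
  funext i
  simp [Complex.mul_conj', hz]

theorem exists_norm_eq_one_pow_mul_conj_pow_eq_neg_one {a b : ℕ} (h : a ≠ b) :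
    ∃ z : ℂ, ‖z‖ = 1 ∧ z ^ a * (starRingEnd ℂ) z ^ b = -1 := by
  have hn : (a : ℂ) - b ≠ 0 := sub_ne_zero.2 (by exact_mod_cast h)
  refine ⟨Complex.exp (((Real.pi / ((a : ℝ) - b) : ℝ) : ℂ) * Complex.I),
    Complex.norm_exp_ofReal_mul_I _, ?_⟩
  rw [← Complex.exp_conj, ← Complex.exp_nat_mul, ← Complex.exp_nat_mul, ← Complex.exp_add,
    ← Complex.exp_pi_mul_I]
  congr 1
  simp only [map_mul, Complex.conj_ofReal, Complex.conj_I]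
  push_cast
  field_simp
  ring

end Unitary

section HaarMoment

open Matrix

variable {ι : Type*} [Fintype ι] [DecidableEq ι] [MeasurableSpace (unitaryGroup ι ℂ)]
  [BorelSpace (unitaryGroup ι ℂ)] (μ : Measure (unitaryGroup ι ℂ))

theorem integral_mulVec_mulVec_eq [μ.IsMulLeftInvariant] (W : unitaryGroup ι ℂ)
    (φ : ι → ℂ) (f : (ι → ℂ) → ℂ) :
    ∫ U, f ((W : Matrix ι ι ℂ) *ᵥ ((U : Matrix ι ι ℂ) *ᵥ φ)) ∂μ =
      ∫ U, f ((U : Matrix ι ι ℂ) *ᵥ φ) ∂μ := by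
  rw [← integral_mul_left_eq_self (fun U : unitaryGroup ι ℂ => f ((U : Matrix ι ι ℂ) *ᵥ φ)) W]
  simp [mulVec_mulVec]

theorem integrable_comp_unitary_mulVec [IsFiniteMeasure μ] (φ : ι → ℂ) {f : (ι → ℂ) → ℂ}
    (hf : Continuous f) :
    Integrable (fun U : unitaryGroup ι ℂ => f ((U : Matrix ι ι ℂ) *ᵥ φ)) μ := by
  have hcont : Continuous fun U : unitaryGroup ι ℂ => (U : Matrix ι ι ℂ) *ᵥ φ :=
    continuous_subtype_val.matrix_mulVec continuous_const
  set R := √(∑ i, ‖φ i‖ ^ 2)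
  obtain ⟨C, hC⟩ := (isCompact_closedBall (0 : ι → ℂ) R).exists_bound_of_continuousOn
    hf.continuousOn
  refine Integrable.of_bound (hf.comp hcont).aestronglyMeasurable C (ae_of_all _ fun U => hC _ ?_)
  rw [mem_closedBall_zero_iff, pi_norm_le_iff_of_nonneg (Real.sqrt_nonneg _)]
  intro i
  refine Real.le_sqrt_of_sq_le ?_
  rw [← sum_norm_sq_unitary_mulVec U φ]
  exact Finset.single_le_sum (f := fun i => ‖((U : Matrix ι ι ℂ) *ᵥ φ) i‖ ^ 2)
    (fun _ _ => by positivity) (Finset.mem_univ i)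

/-- The mixed moment `∫ ψ ^ α * conj ψ ^ β` of the random vector `ψ = U φ`. -/
noncomputable def unitaryMoment (φ : ι → ℂ) (α β : ι → ℕ) : ℂ :=
  ∫ U : unitaryGroup ι ℂ, ∏ i, (((U : Matrix ι ι ℂ) *ᵥ φ) i ^ α i *
    (starRingEnd ℂ) (((U : Matrix ι ι ℂ) *ᵥ φ) i) ^ β i) ∂μ

theorem unitaryMoment_eq_zero [μ.IsMulLeftInvariant] (φ : ι → ℂ) {α β : ι → ℕ} (h : α ≠ β) :
    unitaryMoment μ φ α β = 0 := by
  obtain ⟨i₀, hi₀⟩ := Function.ne_iff.1 h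
  obtain ⟨z, hz, hzpow⟩ := exists_norm_eq_one_pow_mul_conj_pow_eq_neg_one hi₀
  let w : ι → ℂ := Function.update 1 i₀ z
  have hw (i) : ‖w i‖ = 1 := by
    by_cases hi : i = i₀
    · subst hi; simp [w, hz]
    · simp [w, hi]
  have hprod : ∏ i, (w i ^ α i * (starRingEnd ℂ) (w i) ^ β i) = -1 := by
    rw [Finset.prod_eq_single i₀ (fun i _ hi => by simp [w, hi]) (by simp)]
    simpa [w] using hzpow
  have key := integral_mulVec_mulVec_eq μ ⟨diagonal w, mem_unitaryGroup_diagonal hw⟩ φ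
    fun ψ => ∏ i, (ψ i ^ α i * (starRingEnd ℂ) (ψ i) ^ β i)
  have hneg : unitaryMoment μ φ α β = -unitaryMoment μ φ α β := by
    conv_lhs => rw [unitaryMoment, ← key]
    rw [unitaryMoment, ← integral_neg]
    refine integral_congr_ae (ae_of_all _ fun U => ?_)
    simp only [mulVec_diagonal, map_mul, mul_pow]
    rw [← neg_one_mul, ← hprod, ← Finset.prod_mul_distrib]
    exact Finset.prod_congr rfl fun i _ => by ring
  exact self_eq_neg.1 hneg

open Finset in
theorem integral_norm_sum_pow_eq_sum_unitaryMoment [IsFiniteMeasure μ] [μ.IsMulLeftInvariant]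
    (φ : ι → ℂ) (k : ℕ) (t : ι → ℝ) (ht : ∀ i, 0 ≤ t i) :
    ∫ U : unitaryGroup ι ℂ, (∑ i, (√(t i) : ℂ) * ((U : Matrix ι ι ℂ) *ᵥ φ) i) ^ k *
      (starRingEnd ℂ) (∑ i, (√(t i) : ℂ) * ((U : Matrix ι ι ℂ) *ᵥ φ) i) ^ k ∂μ =
    ∑ α ∈ piAntidiag univ k, (Nat.multinomial univ α : ℂ) ^ 2 * unitaryMoment μ φ α α *
      ∏ i, (t i : ℂ) ^ α i := by
  have hexp (ψ : ι → ℂ) : (∑ i, (√(t i) : ℂ) * ψ i) ^ k *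
      (starRingEnd ℂ) (∑ i, (√(t i) : ℂ) * ψ i) ^ k =
      ∑ α ∈ piAntidiag univ k, ∑ β ∈ piAntidiag univ k,
        ((Nat.multinomial univ α : ℂ) * Nat.multinomial univ β *
          ∏ i, (√(t i) : ℂ) ^ (α i + β i)) * ∏ i, (ψ i ^ α i * (starRingEnd ℂ) (ψ i) ^ β i) := by
    simp only [map_sum, map_mul, Complex.conj_ofReal]
    rw [sum_pow_eq_sum_piAntidiag, sum_pow_eq_sum_piAntidiag, sum_mul_sum]
    refine sum_congr rfl fun α _ => sum_congr rfl fun β _ => ?_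
    simp only [mul_pow, prod_mul_distrib, pow_add]
    ring
  have hint (α β : ι → ℕ) (c : ℂ) : Integrable (fun U : unitaryGroup ι ℂ =>
      c * ∏ i, (((U : Matrix ι ι ℂ) *ᵥ φ) i ^ α i *
        (starRingEnd ℂ) (((U : Matrix ι ι ℂ) *ᵥ φ) i) ^ β i)) μ :=
    integrable_comp_unitary_mulVec μ φ
      (f := fun ψ => c * ∏ i, (ψ i ^ α i * (starRingEnd ℂ) (ψ i) ^ β i)) (by fun_prop)
  simp only [hexp]
  rw [integral_finsetSum _ fun α _ => integrable_finsetSum _ fun β _ => hint α β _]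
  refine sum_congr rfl fun α hα => ?_
  rw [integral_finsetSum _ fun β _ => hint α β _]
  simp only [integral_const_mul]
  rw [sum_eq_single_of_mem α hα]
  · have hsq (i) : (√(t i) : ℂ) ^ (α i + α i) = (t i : ℂ) ^ α i := by
      rw [← two_mul, pow_mul, ← Complex.ofReal_pow, Real.sq_sqrt (ht i)]
    simp only [hsq, unitaryMoment]
    ring
  · intro β _ hβ
    exact mul_eq_zero_of_right _ (unitaryMoment_eq_zero μ φ hβ.symm)

theorem integral_norm_sum_pow_eq [μ.IsMulLeftInvariant] (φ : ι → ℂ) {k : ℕ} (hk : k ≠ 0)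
    (i₀ : ι) (t : ι → ℝ) (ht : ∀ i, 0 ≤ t i) :
    ∫ U : unitaryGroup ι ℂ, (∑ i, (√(t i) : ℂ) * ((U : Matrix ι ι ℂ) *ᵥ φ) i) ^ k *
      (starRingEnd ℂ) (∑ i, (√(t i) : ℂ) * ((U : Matrix ι ι ℂ) *ᵥ φ) i) ^ k ∂μ =
    (∑ i, (t i : ℂ)) ^ k * ∫ U : unitaryGroup ι ℂ, ((U : Matrix ι ι ℂ) *ᵥ φ) i₀ ^ k *
      (starRingEnd ℂ) (((U : Matrix ι ι ℂ) *ᵥ φ) i₀) ^ k ∂μ := by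
  set s : ℝ := ∑ i, t i with hs
  have hs' : ∑ i, (t i : ℂ) = (s : ℂ) := by simp [hs]
  have hs0 : 0 ≤ s := Finset.sum_nonneg fun i _ => ht i
  rw [hs']
  rcases hs0.eq_or_lt with h0 | hpos
  · have hz : ∀ i, t i = 0 := fun i =>
      (Finset.sum_eq_zero_iff_of_nonneg fun i _ => ht i).1 h0.symm i (Finset.mem_univ i)
    simp [hz, ← h0, hk]
  · obtain ⟨W, hW⟩ := exists_unitary_row_eq i₀ (fun i => √(t i) / √s) (by
      simp only [div_pow, Real.sq_sqrt (ht _), Real.sq_sqrt hs0]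
      rw [← Finset.sum_div, ← hs, div_self hpos.ne'])
    have hsqrt : (√s : ℂ) ≠ 0 := Complex.ofReal_ne_zero.2 (Real.sqrt_pos.2 hpos).ne'
    rw [← integral_mulVec_mulVec_eq μ W φ fun ψ => ψ i₀ ^ k * (starRingEnd ℂ) (ψ i₀) ^ k,
      ← integral_const_mul]
    refine integral_congr_ae (ae_of_all _ fun U => ?_)
    have hrow : ∑ i, (√(t i) : ℂ) * ((U : Matrix ι ι ℂ) *ᵥ φ) i =
        (√s : ℂ) * ((W : Matrix ι ι ℂ) *ᵥ ((U : Matrix ι ι ℂ) *ᵥ φ)) i₀ := by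
      rw [mulVec, dotProduct, Finset.mul_sum]
      refine Finset.sum_congr rfl fun i _ => ?_
      rw [hW]
      push_cast
      field_simp
    have hss : (s : ℂ) ^ k = (√s : ℂ) ^ k * (√s : ℂ) ^ k := by
      rw [← mul_pow, ← Complex.ofReal_mul, Real.mul_self_sqrt hs0]
    simp only [hrow, map_mul, Complex.conj_ofReal, hss]
    ring

open Finset in
theorem sum_multinomial_mul_unitaryMoment [IsProbabilityMeasure μ] (φ : ι → ℂ)
    (hφ : ∑ i, ‖φ i‖ ^ 2 = 1) (k : ℕ) :
    ∑ α ∈ piAntidiag univ k, (Nat.multinomial univ α : ℂ) * unitaryMoment μ φ α α = 1 := by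
  have hone (U : unitaryGroup ι ℂ) : ∑ α ∈ piAntidiag univ k, (Nat.multinomial univ α : ℂ) *
      ∏ i, (((U : Matrix ι ι ℂ) *ᵥ φ) i ^ α i *
        (starRingEnd ℂ) (((U : Matrix ι ι ℂ) *ᵥ φ) i) ^ α i) = 1 := by
    simp only [← mul_pow]
    rw [← sum_pow_eq_sum_piAntidiag]
    simp only [Complex.mul_conj']
    have := sum_norm_sq_unitary_mulVec U φ
    rw [hφ] at this
    rw [show ∑ i, (‖((U : Matrix ι ι ℂ) *ᵥ φ) i‖ : ℂ) ^ 2 = 1 by exact_mod_cast this, one_pow]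
  simp only [unitaryMoment, ← integral_const_mul]
  rw [← integral_finsetSum]
  · simp only [hone]
    simp
  · intro α _
    exact integrable_comp_unitary_mulVec μ φ
      (f := fun ψ => (Nat.multinomial univ α : ℂ) *
        ∏ i, (ψ i ^ α i * (starRingEnd ℂ) (ψ i) ^ α i)) (by fun_prop)

open Finset in
theorem unitaryMoment_self_eq [IsProbabilityMeasure μ] [μ.IsMulLeftInvariant] [Nonempty ι]
    (φ : ι → ℂ) (hφ : ∑ i, ‖φ i‖ ^ 2 = 1) {k : ℕ} (hk : k ≠ 0) {α : ι → ℕ}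
    (hα : α ∈ piAntidiag univ k) :
    unitaryMoment μ φ α α = (#(piAntidiag (univ : Finset ι) k) : ℂ)⁻¹ * (k.factorial : ℂ)⁻¹ *
      ((∏ i, (α i).factorial : ℕ) : ℂ) := by
  obtain ⟨i₀⟩ := ‹Nonempty ι›
  set c := ∫ U : unitaryGroup ι ℂ, ((U : Matrix ι ι ℂ) *ᵥ φ) i₀ ^ k *
      (starRingEnd ℂ) (((U : Matrix ι ι ℂ) *ᵥ φ) i₀) ^ k ∂μ
  have hne (α : ι → ℕ) : (Nat.multinomial univ α : ℂ) ≠ 0 :=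
    Nat.cast_ne_zero.2 (Nat.multinomial_pos _ _).ne'
  have hconst : ∀ α ∈ piAntidiag univ k,
      (Nat.multinomial univ α : ℂ) * unitaryMoment μ φ α α = c := by
    intro α hα
    have := coeff_eq_of_forall_sum_eq k
      (fun α => (Nat.multinomial univ α : ℂ) ^ 2 * unitaryMoment μ φ α α)
      (fun α => c * (Nat.multinomial univ α : ℂ)) (fun t ht => by
        rw [← integral_norm_sum_pow_eq_sum_unitaryMoment μ φ k t ht,
          integral_norm_sum_pow_eq μ φ hk i₀ t ht, sum_pow_eq_sum_piAntidiag, sum_mul]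
        exact sum_congr rfl fun α _ => by ring) α hα
    refine mul_right_cancel₀ (hne α) ?_
    linear_combination this
  have hc : (#(piAntidiag (univ : Finset ι) k) : ℂ) * c = 1 := by
    rw [← sum_multinomial_mul_unitaryMoment μ φ hφ k, sum_congr rfl hconst, sum_const,
      nsmul_eq_mul]
  have hspec : ((∏ i, (α i).factorial : ℕ) : ℂ) * Nat.multinomial univ α = k.factorial := by
    rw [← (mem_piAntidiag.1 hα).1]
    exact_mod_cast Nat.multinomial_spec univ α
  have hk' : (k.factorial : ℂ) ≠ 0 := Nat.cast_ne_zero.2 k.factorial_ne_zero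
  rw [← eq_inv_of_mul_eq_one_right hc]
  refine mul_left_cancel₀ (mul_ne_zero (hne α) hk') ?_
  rw [mul_right_comm, hconst α hα]
  calc c * (k.factorial : ℂ)
      = c * (((∏ i, (α i).factorial : ℕ) : ℂ) * Nat.multinomial univ α) *
        ((k.factorial : ℂ) * (k.factorial : ℂ)⁻¹) := by rw [hspec, mul_inv_cancel₀ hk', mul_one]
    _ = _ := by ring

end HaarMoment

/-- Schur's lemma averaging formula for the symmetric subspace: the Haar average of
the `k`-fold tensor power of a random pure state `U φ₀` equals `1/dim` times the
projection onto the symmetric subspace of `(ℂ^d)^{⊗ k}`. -/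
theorem haar_average_tensor_power (k d : ℕ) (hk : 0 < k) (hd : 0 < d)
    [MeasurableSpace (Matrix.unitaryGroup (Fin d) ℂ)]
    [BorelSpace (Matrix.unitaryGroup (Fin d) ℂ)]
    (μ : Measure (Matrix.unitaryGroup (Fin d) ℂ))
    [μ.IsHaarMeasure] [IsProbabilityMeasure μ]
    (φ₀ : Fin d → ℂ) (hφ₀ : ∑ i, ‖φ₀ i‖ ^ 2 = 1)
    (x y : Fin k → Fin d) :
    (∫ U : Matrix.unitaryGroup (Fin d) ℂ,
        ∏ j : Fin k,
          ((U : Matrix (Fin d) (Fin d) ℂ).mulVec φ₀ (x j) *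
            (starRingEnd ℂ) ((U : Matrix (Fin d) (Fin d) ℂ).mulVec φ₀ (y j))) ∂μ)
      = (((k + d - 1).choose (d - 1) : ℂ))⁻¹ * ((Nat.factorial k : ℂ))⁻¹ *
        ∑ σ : Equiv.Perm (Fin k), ∏ j : Fin k,
          (if x j = y (σ j) then (1 : ℂ) else 0) := by
  have hprod (U : Matrix.unitaryGroup (Fin d) ℂ) : ∏ j : Fin k,
      ((U : Matrix (Fin d) (Fin d) ℂ).mulVec φ₀ (x j) *
        (starRingEnd ℂ) ((U : Matrix (Fin d) (Fin d) ℂ).mulVec φ₀ (y j))) =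
      ∏ i, ((U : Matrix (Fin d) (Fin d) ℂ).mulVec φ₀ i ^ (Finset.univ.filter (x · = i)).card *
        (starRingEnd ℂ) ((U : Matrix (Fin d) (Fin d) ℂ).mulVec φ₀ i) ^
          (Finset.univ.filter (y · = i)).card) := by
    rw [Finset.prod_mul_distrib, Finset.prod_mul_distrib]
    congr 1
    · rw [← Finset.prod_fiberwise' Finset.univ x]
      simp
    · rw [← Finset.prod_fiberwise' Finset.univ y
        fun i => (starRingEnd ℂ) ((U : Matrix (Fin d) (Fin d) ℂ).mulVec φ₀ i)]
      simp
  simp only [hprod]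
  rw [sum_perm_prod_ite]
  change unitaryMoment μ φ₀ (fun i => (Finset.univ.filter (x · = i)).card)
    (fun i => (Finset.univ.filter (y · = i)).card) = _
  split_ifs with h
  · have : Nonempty (Fin d) := ⟨⟨0, hd⟩⟩
    rw [← h, unitaryMoment_self_eq μ φ₀ hφ₀ hk.ne', card_piAntidiag_univ_s11 d k hd]
    rw [Finset.mem_piAntidiag]
    exact ⟨by simpa using (Finset.card_eq_sum_card_fiberwise (f := x) (s := Finset.univ)
      (t := Finset.univ) (by simp)).symm, by simp⟩
  · rw [unitaryMoment_eq_zero μ φ₀ h, mul_zero]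
end
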